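/- arXiv:0804.1392 — 7 statements merged into one kernel-verified Lean document; each statement's English description precedes it below -/
import Mathlib

section
/- Let n ≥ 1 be an integer and z > 0 a real number with n > z²/3 (equivalently θ = z²/n < 3). For k = 0,…,n define the Wald upper limit U(k) = k/n + z√((k/n)(1−k/n)/n). Then U is monotonically increasing in k on the range where it stays in [0,1]: for all integers 0 ≤ j < k ≤ n, if U(j) ≤ 1 and U(k) ≤ 1 then U(j) ≤ U(k). -/
/-- If `t * y ≤ 1 - y`, then `x ↦ x + √(t * (x * (1 - x)))` is monotone on `[0, y]`. -/
theorem add_sqrt_mul_one_sub_le {t x y : ℝ} (ht : 0 ≤ t) (hx : 0 ≤ x) (hxy : x ≤ y)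
    (hy : t * y ≤ 1 - y) :
    x + √(t * (x * (1 - x))) ≤ y + √(t * (y * (1 - y))) := by
  have hy0 : 0 ≤ y := hx.trans hxy
  have hx' : t * x ≤ 1 - x := by nlinarith
  have hy1 : 0 ≤ 1 - y := (mul_nonneg ht hy0).trans hy
  have hx1 : 0 ≤ 1 - x := by linarith
  have ha : t * x ≤ √(t * (x * (1 - x))) := by
    apply Real.le_sqrt_of_sq_le
    nlinarith [mul_le_mul_of_nonneg_left hx' (mul_nonneg ht hx)]
  have hb : t * y ≤ √(t * (y * (1 - y))) := by
    apply Real.le_sqrt_of_sq_le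
    nlinarith [mul_le_mul_of_nonneg_left hy (mul_nonneg ht hy0)]
  have ha2 := Real.sq_sqrt (show 0 ≤ t * (x * (1 - x)) by positivity)
  have hb2 := Real.sq_sqrt (show 0 ≤ t * (y * (1 - y)) by positivity)
  have ha0 := Real.sqrt_nonneg (t * (x * (1 - x)))
  have hb0 := Real.sqrt_nonneg (t * (y * (1 - y)))
  set a := √(t * (x * (1 - x)))
  set b := √(t * (y * (1 - y)))
  by_contra! h
  have hsum : 0 < a + b := by linarith
  have hdiff : (a - b) * (a + b) = (y - x) * (t * (x + y - 1)) := by linear_combination ha2 - hb2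
  have hle : (y - x) * (t * (x + y - 1)) ≤ (y - x) * (a + b) :=
    mul_le_mul_of_nonneg_left (by linarith) (by linarith)
  have hlt : (y - x) * (a + b) < (a - b) * (a + b) :=
    mul_lt_mul_of_pos_right (by linarith) hsum
  linarith

/-- If `y < 1` and `y + √(t * (y * (1 - y))) ≤ 1`, then `t * y ≤ 1 - y`. -/
theorem mul_le_one_sub_of_add_sqrt_le_one {t y : ℝ} (hy : y < 1)
    (h : y + √(t * (y * (1 - y))) ≤ 1) : t * y ≤ 1 - y := by
  have hs : t * (y * (1 - y)) ≤ (1 - y) ^ 2 :=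
    (Real.sqrt_le_left (by linarith)).1 (by linarith)
  refine le_of_mul_le_mul_right ?_ (sub_pos.2 hy)
  linarith

/-- for `n > z²/3`, the Wald upper confidence limit
`U(k) = k/n + z√((k/n)(1−k/n)/n)` is monotonically increasing in `k` on the
range where it stays in `[0,1]`. -/
theorem wald_upper_limit_monotone (n : ℕ) (hn : 1 ≤ n) (z : ℝ) (hz : 0 < z)
    (hn3 : (n : ℝ) > z ^ 2 / 3)
    (U : ℕ → ℝ)
    (hU : ∀ k, U k = (k : ℝ) / n + z * Real.sqrt (((k : ℝ) / n) * (1 - (k : ℝ) / n) / n)) :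
    ∀ j k : ℕ, j < k → k ≤ n → U j ≤ 1 → U k ≤ 1 → U j ≤ U k := by
  intro j k hjk hkn hj hk
  have hn0 : (0 : ℝ) < n := by exact_mod_cast hn
  have hU' (i : ℕ) :
      U i = (i : ℝ) / n + √(z ^ 2 / n * ((i : ℝ) / n * (1 - (i : ℝ) / n))) := by
    rw [hU, div_mul_eq_mul_div (z ^ 2), mul_div_assoc (z ^ 2), Real.sqrt_mul (sq_nonneg z), Real.sqrt_sq hz.le]
  rcases hkn.eq_or_lt with rfl | hlt
  · have hUk : U k = 1 := by simp [hU, hn0.ne']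
    rwa [hUk]
  · have hk1 : (k : ℝ) / n < 1 := (div_lt_one hn0).2 (by exact_mod_cast hlt)
    have hjk' : (j : ℝ) / n ≤ (k : ℝ) / n := by gcongr
    rw [hU'] at hk
    rw [hU', hU']
    exact add_sqrt_mul_one_sub_le (by positivity) (by positivity) hjk'
      (mul_le_one_sub_of_add_sqrt_le_one hk1 hk)
end

section
/- Let n ≥ 1 be an integer and z > 0 a real number with n > z²/3 (equivalently θ = z²/n < 3). For k = 0,…,n define the Wald lower limit L(k) = k/n − z√((k/n)(1−k/n)/n). Then L is monotonically increasing in k on the range where it stays in [0,1]: for all integers 0 ≤ j < k ≤ n, if L(j) ≥ 0 and L(k) ≥ 0 then L(j) ≤ L(k). -/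
/-- The standard error of a proportion, relative to the proportion, is antitone. -/
lemma sqrt_mul_one_sub_div_mul_le {x y m : ℝ} (hx : 0 ≤ x) (hxy : x ≤ y) (hy : y ≤ 1)
    (hm : 0 ≤ m) :
    √(y * (1 - y) / m) * x ≤ √(x * (1 - x) / m) * y := by
  have hy0 : 0 ≤ y := hx.trans hxy
  have hvx : 0 ≤ x * (1 - x) / m := div_nonneg (mul_nonneg hx (by linarith)) hm
  have hvy : 0 ≤ y * (1 - y) / m := div_nonneg (mul_nonneg hy0 (by linarith)) hm
  refine (sq_le_sq₀ (by positivity) (by positivity)).1 ?_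
  rw [mul_pow, mul_pow, Real.sq_sqrt hvx, Real.sq_sqrt hvy, div_mul_eq_mul_div,
    div_mul_eq_mul_div]
  refine div_le_div_of_nonneg_right ?_ hm
  nlinarith [mul_nonneg (mul_nonneg hx hy0) (sub_nonneg.2 hxy)]

/-- for `n > z²/3`, the Wald lower confidence limit
`L(k) = k/n − z√((k/n)(1−k/n)/n)` is monotonically increasing in `k` on the
range where it stays in `[0,1]`. -/
theorem wald_lower_limit_monotone (n : ℕ) (hn : 1 ≤ n) (z : ℝ) (hz : 0 < z)
    (hn3 : (n : ℝ) > z ^ 2 / 3)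
    (L : ℕ → ℝ)
    (hL : ∀ k, L k = (k : ℝ) / n - z * Real.sqrt (((k : ℝ) / n) * (1 - (k : ℝ) / n) / n)) :
    ∀ j k : ℕ, j < k → k ≤ n → 0 ≤ L j → 0 ≤ L k → L j ≤ L k := by
  intro j k hjk hkn hj hk
  rcases Nat.eq_zero_or_pos j with rfl | hj0
  · have h0 : L 0 = 0 := by simp [hL]
    rwa [h0]
  have hnpos : (0 : ℝ) < n := by exact_mod_cast hn
  rw [hL] at hj
  rw [hL, hL]
  have hx : (0 : ℝ) < (j : ℝ) / n := by positivity
  have hxy : (j : ℝ) / n ≤ (k : ℝ) / n := by gcongr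
  have hy : (k : ℝ) / n ≤ 1 := (div_le_one hnpos).2 (by exact_mod_cast hkn)
  have key := mul_le_mul_of_nonneg_left
    (sqrt_mul_one_sub_div_mul_le hx.le hxy hy hnpos.le) hz.le
  generalize (j : ℝ) / n = x at *
  generalize (k : ℝ) / n = y at *
  refine le_of_mul_le_mul_right ?_ hx
  nlinarith [mul_nonneg (sub_nonneg.2 hxy) hj]
end

section
/- Let 0 < θ < 3 and define h(t) = t + √(θ t(1−t)) for t ∈ [0,1]. Then h is strictly increasing on the interval [0, 1/(1+θ)]. -/
theorem mul_le_sqrt_mul_mul_one_sub {θ t : ℝ} (hθ : 0 < θ)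
    (ht : t ∈ Set.Icc (0 : ℝ) (1 / (1 + θ))) : θ * t ≤ Real.sqrt (θ * (t * (1 - t))) := by
  have h1 : t * (1 + θ) ≤ 1 := (le_div_iff₀ (by linarith)).1 ht.2
  have h2 : 0 ≤ θ * t * (1 - t * (1 + θ)) :=
    mul_nonneg (mul_nonneg hθ.le ht.1) (by linarith)
  exact Real.le_sqrt_of_sq_le (by linarith)

/-- for `0 < θ < 3`, the function `h(t) = t + √(θ t(1−t))`
is strictly increasing on `[0, 1/(1+θ)]`. -/
theorem wald_upper_strictMono (θ : ℝ) (hθ0 : 0 < θ) (hθ3 : θ < 3)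
    (h : ℝ → ℝ) (hh : ∀ t, h t = t + Real.sqrt (θ * (t * (1 - t)))) :
    StrictMonoOn h (Set.Icc (0 : ℝ) (1 / (1 + θ))) := by
  have le_one {t : ℝ} (ht : t ∈ Set.Icc (0 : ℝ) (1 / (1 + θ))) : t ≤ 1 :=
    ht.2.trans ((div_le_one (by linarith)).2 (by linarith))
  have nonneg {t : ℝ} (ht : t ∈ Set.Icc (0 : ℝ) (1 / (1 + θ))) : 0 ≤ θ * (t * (1 - t)) :=
    mul_nonneg hθ0.le (mul_nonneg ht.1 (sub_nonneg.2 (le_one ht)))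
  intro a ha b hb hab
  rw [hh, hh]
  have hu := mul_le_sqrt_mul_mul_one_sub hθ0 ha
  have hv := mul_le_sqrt_mul_mul_one_sub hθ0 hb
  have hu2 := Real.sq_sqrt (nonneg ha)
  have hv2 := Real.sq_sqrt (nonneg hb)
  set u := Real.sqrt (θ * (a * (1 - a)))
  set v := Real.sqrt (θ * (b * (1 - b)))
  by_contra! hle
  have hsum : θ * (a + b - 1) < u + v := by linarith
  have hpos : 0 ≤ u + v :=
    add_nonneg ((mul_nonneg hθ0.le ha.1).trans hu) ((mul_nonneg hθ0.le hb.1).trans hv)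
  have h1 : (b - a) * (θ * (a + b - 1)) < (b - a) * (u + v) :=
    mul_lt_mul_of_pos_left hsum (sub_pos.2 hab)
  have h2 : (b - a) * (u + v) ≤ (u - v) * (u + v) :=
    mul_le_mul_of_nonneg_right (by linarith) hpos
  linarith
end

section
/- Let n ≥ 1 be an integer and z > 0 with θ = z²/n < 3. For k = 0,…,n define L(k) = k/n − z√((k/n)(1−k/n)/n) and U(k) = k/n + z√((k/n)(1−k/n)/n), and for p ∈ [0,1] define T⁺(p) = (2p + θ + √(θ² + 4θp(1−p)))/(2(1+θ)). Fix k ∈ {0,…,n} with 0 < U(k) < 1 and set p = U(k). Then Σ_{j=0}^{n} 𝟙[L(j) ≤ p < U(j)] · C(n,j) p^j (1−p)^{n−j} = Σ_{j : k < j ≤ n·T⁺(p)} C(n,j) p^j (1−p)^{n−j}. -/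
/-- The ratio `√(θ x (1 - x)) / (1 - x)` is monotone on `[0, 1)`, in product form. -/
lemma one_sub_mul_sqrt_le {θ x y : ℝ} (hθ : 0 ≤ θ) (hx : 0 ≤ x) (hxy : x ≤ y) (hy : y ≤ 1) :
    (1 - y) * √(θ * (x * (1 - x))) ≤ (1 - x) * √(θ * (y * (1 - y))) := by
  have hx1 : 0 ≤ 1 - x := by linarith
  have hy1 : 0 ≤ 1 - y := by linarith
  have hy0 : 0 ≤ y := hx.trans hxy
  refine abs_le_of_sq_le_sq' ?_ (by positivity) |>.2
  rw [mul_pow, mul_pow, Real.sq_sqrt (by positivity), Real.sq_sqrt (by positivity)]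
  have h : 0 ≤ θ * ((1 - x) * (1 - y)) * (y - x) :=
    mul_nonneg (by positivity) (by linarith)
  linarith

/-- Where the upper Wald endpoint lies below `1`, comparing endpoints is comparing estimates. -/
lemma wald_upper_lt_iff {θ x y : ℝ} (hθ : 0 ≤ θ) (hx : 0 ≤ x) (hy : 0 ≤ y) (hy1 : y ≤ 1)
    (hx1 : x + √(θ * (x * (1 - x))) < 1) :
    x + √(θ * (x * (1 - x))) < y + √(θ * (y * (1 - y))) ↔ x < y := by
  have hs := Real.sqrt_nonneg (θ * (x * (1 - x)))
  have hx' : 0 < 1 - x := by linarith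
  constructor
  · intro h
    by_contra! hyx
    have key := one_sub_mul_sqrt_le hθ hy hyx (by linarith)
    nlinarith [mul_pos hx' (sub_pos.2 h), mul_nonneg (sub_nonneg.2 hyx) (sub_pos.2 hx1).le]
  · intro hxy
    have key := one_sub_mul_sqrt_le hθ hx hxy.le hy1
    by_contra! h
    nlinarith [mul_nonneg hx'.le (sub_nonneg.2 h), mul_pos (sub_pos.2 hxy) (sub_pos.2 hx1)]

/-- The lower Wald endpoint is at most `p` iff the estimate is at most the larger root of
`(p - t)² = θ t (1 - t)`. -/
lemma wald_lower_le_iff {θ x p : ℝ} (hθ : 0 < θ) (hx : 0 ≤ x) (hx1 : x ≤ 1)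
    (hp : 0 < p) (hp1 : p < 1) :
    x - √(θ * (x * (1 - x))) ≤ p ↔
      x ≤ (2 * p + θ + √(θ ^ 2 + 4 * θ * p * (1 - p))) / (2 * (1 + θ)) := by
  have hx' : 0 ≤ 1 - x := by linarith
  have hp' : 0 < 1 - p := by linarith
  have hs := Real.sqrt_nonneg (θ * (x * (1 - x)))
  have hs2 := Real.sq_sqrt (show 0 ≤ θ * (x * (1 - x)) by positivity)
  have hD2 := Real.sq_sqrt (show 0 ≤ θ ^ 2 + 4 * θ * p * (1 - p) by positivity)
  have hD : θ ≤ √(θ ^ 2 + 4 * θ * p * (1 - p)) :=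
    Real.le_sqrt_of_sq_le (le_add_of_nonneg_right (by positivity))
  rw [le_div_iff₀ (by positivity)]
  set s := √(θ * (x * (1 - x)))
  set D := √(θ ^ 2 + 4 * θ * p * (1 - p))
  have key : (x * (2 * (1 + θ)) - 2 * p - θ) ^ 2 - D ^ 2
      = 4 * (1 + θ) * ((x - p) ^ 2 - s ^ 2) := by
    rw [hs2, hD2]; ring
  have hθx : 0 ≤ θ * x := by positivity
  have hθx' : 0 ≤ θ * (1 - x) := by positivity
  constructor
  · intro h
    rcases le_total p x with hpx | hpx
    · have h1 : (x - p) ^ 2 ≤ s ^ 2 := pow_le_pow_left₀ (by linarith) (by linarith) 2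
      have h2 : (x * (2 * (1 + θ)) - 2 * p - θ) ^ 2 ≤ D ^ 2 := by
        have : 0 ≤ 4 * (1 + θ) * (s ^ 2 - (x - p) ^ 2) :=
          mul_nonneg (by positivity) (by linarith)
        linarith
      have := (abs_le_of_sq_le_sq' h2 (by linarith)).2
      linarith
    · linarith
  · intro h
    by_contra! hlt
    have h1 : s ^ 2 < (x - p) ^ 2 := pow_lt_pow_left₀ (by linarith) hs two_ne_zero
    have h2 : (x * (2 * (1 + θ)) - 2 * p - θ) ^ 2 ≤ D ^ 2 :=
      sq_le_sq' (by linarith) (by linarith)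
    have : 0 < 4 * (1 + θ) * ((x - p) ^ 2 - s ^ 2) :=
      mul_pos (by positivity) (by linarith)
    linarith


/-- at `p = U(k)`, the coverage sum of the left-closed right-open
Wald interval equals `Pr{k < K ≤ n·T⁺(p)}`. -/
theorem wald_coverage_at_upper (n : ℕ) (hn : 1 ≤ n) (z : ℝ) (hz : 0 < z)
    (θ : ℝ) (hθdef : θ = z ^ 2 / n) (hθ : θ < 3)
    (L U : ℕ → ℝ)
    (hL : ∀ k, L k = (k : ℝ) / n - z * Real.sqrt (((k : ℝ) / n) * (1 - (k : ℝ) / n) / n))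
    (hU : ∀ k, U k = (k : ℝ) / n + z * Real.sqrt (((k : ℝ) / n) * (1 - (k : ℝ) / n) / n))
    (Tp : ℝ → ℝ)
    (hTp : ∀ p, Tp p = (2 * p + θ + Real.sqrt (θ ^ 2 + 4 * θ * p * (1 - p))) / (2 * (1 + θ)))
    (k : ℕ) (hk : k ≤ n) (p : ℝ) (hp : p = U k) (hp0 : 0 < p) (hp1 : p < 1) :
    ∑ j ∈ Finset.range (n + 1),
      (if L j ≤ p ∧ p < U j then (1 : ℝ) else 0) * (n.choose j) * p ^ j * (1 - p) ^ (n - j) =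
    ∑ j ∈ Finset.range (n + 1),
      (if k < j ∧ (j : ℝ) ≤ (n : ℝ) * Tp p then (1 : ℝ) else 0) *
        (n.choose j) * p ^ j * (1 - p) ^ (n - j) := by
  have hn0 : (0 : ℝ) < n := by exact_mod_cast hn
  have hθ0 : 0 < θ := by rw [hθdef]; positivity
  have hsqrt : ∀ x : ℝ, z * √(x * (1 - x) / n) = √(θ * (x * (1 - x))) := by
    intro x
    rw [show θ * (x * (1 - x)) = z ^ 2 * (x * (1 - x) / n) by rw [hθdef]; ring,
      Real.sqrt_mul (sq_nonneg z), Real.sqrt_sq hz.le]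
  refine Finset.sum_congr rfl fun j hj => ?_
  have hj' : (j : ℝ) / n ≤ 1 := by
    rw [div_le_one hn0]
    exact_mod_cast Finset.mem_range_succ_iff.1 hj
  have hlow : L j ≤ p ↔ (j : ℝ) ≤ n * Tp p := by
    rw [hL, hsqrt, wald_lower_le_iff hθ0 (by positivity) hj' hp0 hp1, ← hTp, div_le_iff₀' hn0]
  have hup : p < U j ↔ k < j := by
    rw [hp, hU, hsqrt] at hp1
    rw [hp, hU, hU, hsqrt, hsqrt,
      wald_upper_lt_iff hθ0.le (by positivity) (by positivity) hj' hp1,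
      div_lt_div_iff_of_pos_right hn0, Nat.cast_lt]
  simp only [hlow, hup, and_comm]
end

section
/- Let n ≥ 1 be an integer and z > 0 with θ = z²/n < 3. For k = 0,…,n define L(k) = k/n − z√((k/n)(1−k/n)/n) and U(k) = k/n + z√((k/n)(1−k/n)/n), and for p ∈ [0,1] define T⁻(p) = (2p + θ − √(θ² + 4θp(1−p)))/(2(1+θ)). Fix k ∈ {0,…,n} with 0 < L(k) < 1 and set p = L(k). Then Σ_{j=0}^{n} 𝟙[L(j) < p ≤ U(j)] · C(n,j) p^j (1−p)^{n−j} = Σ_{j : n·T⁻(p) ≤ j < k} C(n,j) p^j (1−p)^{n−j}. -/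
/-- Chord inequality for the convex map `x ↦ x - √(θ x (1 - x))`, which vanishes at `0`. -/
lemma wald_lower_chord {θ x y : ℝ} (hθ : 0 ≤ θ) (hx : 0 ≤ x) (hxy : x ≤ y) :
    y * (x - √(θ * (x * (1 - x)))) ≤ x * (y - √(θ * (y * (1 - y)))) := by
  have hy0 : 0 ≤ y := hx.trans hxy
  have key : x * √(θ * (y * (1 - y))) ≤ y * √(θ * (x * (1 - x))) := by
    rw [← Real.sqrt_sq hx, ← Real.sqrt_sq hy0, ← Real.sqrt_mul (sq_nonneg x),
      ← Real.sqrt_mul (sq_nonneg y), Real.sqrt_sq hx, Real.sqrt_sq hy0]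
    apply Real.sqrt_le_sqrt
    have h : 0 ≤ θ * (x * y) * (y - x) :=
      mul_nonneg (mul_nonneg hθ (mul_nonneg hx hy0)) (sub_nonneg.2 hxy)
    linear_combination h
  linarith

/-- Where the lower Wald limit is positive, it determines the order of the sample proportions. -/
lemma wald_lower_lt_iff {θ x y : ℝ} (hθ : 0 ≤ θ) (hx : 0 ≤ x) (hy0 : 0 ≤ y)
    (hL : 0 < y - √(θ * (y * (1 - y)))) :
    x - √(θ * (x * (1 - x))) < y - √(θ * (y * (1 - y))) ↔ x < y := by
  constructor
  · intro h
    by_contra! hyx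
    have hc := wald_lower_chord hθ hy0 hyx
    have hy : 0 < y := by linarith [Real.sqrt_nonneg (θ * (y * (1 - y)))]
    nlinarith
  · intro h
    have hc := wald_lower_chord hθ hx h.le
    nlinarith

/-- The upper Wald limit covers `p` exactly when the sample proportion is at least the smaller
root of `(p - t) ^ 2 = θ * t * (1 - t)`. -/
lemma le_wald_upper_iff {θ p x : ℝ} (hθ : 0 ≤ θ) (hx : 0 ≤ x) (hx1 : x ≤ 1) (hp : 0 ≤ p)
    (hp1 : p ≤ 1) :
    p ≤ x + √(θ * (x * (1 - x))) ↔
      (2 * p + θ - √(θ ^ 2 + 4 * θ * p * (1 - p))) / (2 * (1 + θ)) ≤ x := by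
  have hA : 0 ≤ θ * (x * (1 - x)) := mul_nonneg hθ (mul_nonneg hx (sub_nonneg.2 hx1))
  have hB : 0 ≤ θ * (p * (1 - p)) := mul_nonneg hθ (mul_nonneg hp (sub_nonneg.2 hp1))
  have hD : 0 ≤ θ ^ 2 + 4 * θ * p * (1 - p) := by nlinarith [sq_nonneg θ]
  have hmid : |2 * p + θ - 2 * (1 + θ) * p| ≤ √(θ ^ 2 + 4 * θ * p * (1 - p)) :=
    Real.abs_le_sqrt (by nlinarith [mul_nonneg hθ hB])
  obtain ⟨hmid1, hmid2⟩ := abs_le.1 hmid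
  rw [div_le_iff₀ (by linarith)]
  rcases le_or_gt p x with hpx | hxp
  · have := mul_le_mul_of_nonneg_left hpx hθ
    exact iff_of_true (by linarith [Real.sqrt_nonneg (θ * (x * (1 - x)))]) (by linarith)
  · have := mul_le_mul_of_nonneg_left hxp.le hθ
    constructor
    · intro h
      have hsq : (p - x) ^ 2 ≤ θ * (x * (1 - x)) :=
        (Real.le_sqrt (by linarith) hA).1 (by linarith)
      have hle : 2 * p + θ - 2 * (1 + θ) * x ≤ √(θ ^ 2 + 4 * θ * p * (1 - p)) :=
        Real.le_sqrt_of_sq_le (by nlinarith [mul_le_mul_of_nonneg_left hsq hθ])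
      linarith
    · intro h
      have hsq : (2 * p + θ - 2 * (1 + θ) * x) ^ 2 ≤ θ ^ 2 + 4 * θ * p * (1 - p) := by
        rw [← Real.sq_sqrt hD]
        exact sq_le_sq' (by linarith) (by linarith)
      have hle : p - x ≤ √(θ * (x * (1 - x))) := by
        apply Real.le_sqrt_of_sq_le
        have h4 : 0 < 4 * (1 + θ) := by linarith
        refine le_of_mul_le_mul_left ?_ h4
        linear_combination hsq
      linarith


/-- at `p = L(k)`, the coverage sum of the left-open right-closed
Wald interval equals `Pr{n·T⁻(p) ≤ K < k}`. -/
theorem wald_coverage_at_lower (n : ℕ) (hn : 1 ≤ n) (z : ℝ) (hz : 0 < z)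
    (θ : ℝ) (hθdef : θ = z ^ 2 / n) (hθ : θ < 3)
    (L U : ℕ → ℝ)
    (hL : ∀ k, L k = (k : ℝ) / n - z * Real.sqrt (((k : ℝ) / n) * (1 - (k : ℝ) / n) / n))
    (hU : ∀ k, U k = (k : ℝ) / n + z * Real.sqrt (((k : ℝ) / n) * (1 - (k : ℝ) / n) / n))
    (Tm : ℝ → ℝ)
    (hTm : ∀ p, Tm p = (2 * p + θ - Real.sqrt (θ ^ 2 + 4 * θ * p * (1 - p))) / (2 * (1 + θ)))
    (k : ℕ) (hk : k ≤ n) (p : ℝ) (hp : p = L k) (hp0 : 0 < p) (hp1 : p < 1) :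
    ∑ j ∈ Finset.range (n + 1),
      (if L j < p ∧ p ≤ U j then (1 : ℝ) else 0) * (n.choose j) * p ^ j * (1 - p) ^ (n - j) =
    ∑ j ∈ Finset.range (n + 1),
      (if (n : ℝ) * Tm p ≤ (j : ℝ) ∧ j < k then (1 : ℝ) else 0) *
        (n.choose j) * p ^ j * (1 - p) ^ (n - j) := by
  have hn0 : (0 : ℝ) < n := by exact_mod_cast hn
  have hθ0 : 0 ≤ θ := hθdef ▸ by positivity
  have hsqrt : ∀ x : ℝ, z * √(x * (1 - x) / n) = √(θ * (x * (1 - x))) := by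
    intro x
    rw [show θ * (x * (1 - x)) = z ^ 2 * (x * (1 - x) / n) by rw [hθdef]; ring,
      Real.sqrt_mul (sq_nonneg z), Real.sqrt_sq hz.le]
  simp only [hsqrt] at hL hU
  have hmem : ∀ j ≤ n, 0 ≤ (j : ℝ) / n ∧ (j : ℝ) / n ≤ 1 := fun j hj =>
    ⟨by positivity, (div_le_one hn0).2 (by exact_mod_cast hj)⟩
  refine Finset.sum_congr rfl fun j hj => ?_
  obtain ⟨hj0, hj1⟩ := hmem j (by simpa [Nat.lt_succ_iff] using hj)
  have hk0 := (hmem k hk).1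
  have hlower : L j < p ↔ j < k := by
    rw [hp, hL] at hp0
    rw [hp, hL, hL, wald_lower_lt_iff hθ0 hj0 hk0 hp0, div_lt_div_iff_of_pos_right hn0,
      Nat.cast_lt]
  have hupper : p ≤ U j ↔ (n : ℝ) * Tm p ≤ j := by
    rw [hU, hTm, le_wald_upper_iff hθ0 hj0 hj1 hp0.le hp1.le, le_div_iff₀' hn0]
  simp only [hlower, hupper, and_comm]
end

section
/- Let n ≥ 1 be an integer and z > 0 with θ = z²/n < 3. For k = 0,…,n define L(k) = k/n − z√((k/n)(1−k/n)/n) and U(k) = k/n + z√((k/n)(1−k/n)/n), and for p ∈ [0,1] define T⁺(p) = (2p + θ + √(θ² + 4θp(1−p)))/(2(1+θ)). Fix k ∈ {0,…,n} with 0 < U(k) < 1 and set p = U(k). Then Σ_{j=0}^{n} 𝟙[L(j) < p < U(j)] · C(n,j) p^j (1−p)^{n−j} = Σ_{j : k < j < n·T⁺(p)} C(n,j) p^j (1−p)^{n−j}. -/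
/-- The roots of `(t - p)² = θ t (1 - t)`: a root below `p` and the larger root of the quadratic
formula factor the difference of the two sides. -/
theorem wald_quadratic_factor {θ p u T : ℝ} (hθ : 0 < θ) (hp0 : 0 < p) (hp1 : p < 1)
    (hu : u < p) (hroot : (p - u) ^ 2 = θ * (u * (1 - u)))
    (hT : T = (2 * p + θ + √(θ ^ 2 + 4 * θ * p * (1 - p))) / (2 * (1 + θ))) :
    p < T ∧ ∀ x, (x - p) ^ 2 - θ * (x * (1 - x)) = (1 + θ) * ((x - u) * (x - T)) := by
  have hpq : 0 < θ * (p * (1 - p)) := mul_pos hθ (mul_pos hp0 (sub_pos.2 hp1))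
  set R := √(θ ^ 2 + 4 * θ * p * (1 - p)) with hR
  have hRsq : R ^ 2 = θ ^ 2 + 4 * θ * p * (1 - p) :=
    Real.sq_sqrt (by nlinarith [sq_nonneg θ])
  have hT' : 2 * (1 + θ) * T = 2 * p + θ + R := by
    rw [hT]; field_simp
  have hRgt : 2 * θ * p - θ < R := by
    refine lt_of_pow_lt_pow_left₀ 2 (Real.sqrt_nonneg _) ?_
    rw [hRsq]
    nlinarith [mul_pos hθ hpq]
  have hpT : p < T := by
    refine lt_of_mul_lt_mul_left (a := 2 * (1 + θ)) ?_ (by positivity)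
    rw [hT']
    linarith
  have hrootT : 4 * (1 + θ) * ((1 + θ) * T ^ 2 - (2 * p + θ) * T + p ^ 2) = 0 := by
    linear_combination (2 * (1 + θ) * T + R - (2 * p + θ)) * hT' + hRsq
  have hrootT' : (1 + θ) * T ^ 2 - (2 * p + θ) * T + p ^ 2 = 0 :=
    (mul_eq_zero.1 hrootT).resolve_left (by positivity)
  have hsum : (1 + θ) * (u + T) = 2 * p + θ := by
    refine mul_left_cancel₀ (sub_ne_zero.2 (hu.trans hpT).ne') ?_
    linear_combination hrootT' - hroot
  refine ⟨hpT, fun x => ?_⟩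
  linear_combination (x - u) * hsum + hroot


/-- at `p = U(k)`, the coverage sum of the open Wald interval
equals `Pr{k < K < n·T⁺(p)}`. -/
theorem wald_open_coverage_at_upper (n : ℕ) (hn : 1 ≤ n) (z : ℝ) (hz : 0 < z)
    (θ : ℝ) (hθdef : θ = z ^ 2 / n) (hθ : θ < 3)
    (L U : ℕ → ℝ)
    (hL : ∀ k, L k = (k : ℝ) / n - z * Real.sqrt (((k : ℝ) / n) * (1 - (k : ℝ) / n) / n))
    (hU : ∀ k, U k = (k : ℝ) / n + z * Real.sqrt (((k : ℝ) / n) * (1 - (k : ℝ) / n) / n))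
    (Tp : ℝ → ℝ)
    (hTp : ∀ p, Tp p = (2 * p + θ + Real.sqrt (θ ^ 2 + 4 * θ * p * (1 - p))) / (2 * (1 + θ)))
    (k : ℕ) (hk : k ≤ n) (p : ℝ) (hp : p = U k) (hp0 : 0 < p) (hp1 : p < 1) :
    ∑ j ∈ Finset.range (n + 1),
      (if L j < p ∧ p < U j then (1 : ℝ) else 0) * (n.choose j) * p ^ j * (1 - p) ^ (n - j) =
    ∑ j ∈ Finset.range (n + 1),
      (if k < j ∧ (j : ℝ) < (n : ℝ) * Tp p then (1 : ℝ) else 0) *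
        (n.choose j) * p ^ j * (1 - p) ^ (n - j) := by
  have hn0 : (0 : ℝ) < n := by exact_mod_cast hn
  have hθ0 : 0 < θ := hθdef ▸ by positivity
  set s : ℕ → ℝ := fun j => z * √(((j : ℝ) / n) * (1 - (j : ℝ) / n) / n) with hs
  have hs0 : ∀ j, 0 ≤ s j := fun j => by positivity
  have hssq : ∀ j ≤ n, s j ^ 2 = θ * (((j : ℝ) / n) * (1 - (j : ℝ) / n)) := by
    intro j hj
    have h1 : (j : ℝ) / n ≤ 1 := (div_le_one hn0).2 (by exact_mod_cast hj)
    have h2 : 0 ≤ ((j : ℝ) / n) * (1 - (j : ℝ) / n) :=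
      mul_nonneg (by positivity) (sub_nonneg.2 h1)
    rw [hs, mul_pow, Real.sq_sqrt (div_nonneg h2 hn0.le), hθdef]
    ring
  have hpk : p = k / n + s k := hp.trans (hU k)
  have hroot : (p - k / n) ^ 2 = θ * (((k : ℝ) / n) * (1 - (k : ℝ) / n)) := by
    rw [← hssq k hk, hpk]
    ring
  have hup : (k : ℝ) / n < p := by
    refine lt_of_le_of_ne (by linarith [hs0 k]) fun h => ?_
    rw [h] at hroot
    nlinarith [mul_pos hθ0 (mul_pos hp0 (sub_pos.2 hp1))]
  obtain ⟨hpT, hfac⟩ := wald_quadratic_factor hθ0 hp0 hp1 hup hroot (hTp p)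
  refine Finset.sum_congr rfl fun j hj => ?_
  have hjn : j ≤ n := Nat.lt_succ_iff.1 (Finset.mem_range.1 hj)
  have key : (L j < p ∧ p < U j) ↔ (k < j ∧ (j : ℝ) < (n : ℝ) * Tp p) := by
    calc (L j < p ∧ p < U j) ↔ |(j : ℝ) / n - p| < s j := by
          rw [abs_lt, hL, hU]
          constructor <;> rintro ⟨h1, h2⟩ <;> constructor <;> linarith
      _ ↔ ((j : ℝ) / n - k / n) * ((j : ℝ) / n - Tp p) < 0 := by
          rw [← sq_lt_sq₀ (abs_nonneg _) (hs0 j), sq_abs, hssq j hjn, ← sub_neg, hfac]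
          exact smul_neg_iff_of_pos_left (show 0 < 1 + θ by positivity)
      _ ↔ (k : ℝ) / n < j / n ∧ (j : ℝ) / n < Tp p := by
          constructor
          · intro h
            rcases mul_neg_iff.1 h with h | h <;> constructor <;> linarith
          · rintro ⟨h1, h2⟩
            exact mul_neg_of_pos_of_neg (sub_pos.2 h1) (sub_neg.2 h2)
      _ ↔ (k < j ∧ (j : ℝ) < (n : ℝ) * Tp p) := by
          rw [div_lt_div_iff_of_pos_right hn0, Nat.cast_lt, div_lt_iff₀' hn0]
  simp only [key]
end

section
/- Let n ≥ 1 be an integer and z > 0 with θ = z²/n < 3. For k = 0,…,n define L(k) = k/n − z√((k/n)(1−k/n)/n) and U(k) = k/n + z√((k/n)(1−k/n)/n), and for p ∈ [0,1] define T⁻(p) = (2p + θ − √(θ² + 4θp(1−p)))/(2(1+θ)). Fix k ∈ {0,…,n} with 0 < L(k) < 1 and set p = L(k). Then Σ_{j=0}^{n} 𝟙[L(j) < p < U(j)] · C(n,j) p^j (1−p)^{n−j} = Σ_{j : n·T⁻(p) < j < k} C(n,j) p^j (1−p)^{n−j}. -/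
/-- The quadratic `(p - t)² - θ t (1 - t)`, with roots `T` (the smaller one) and `κ > p`, is negative
exactly between its roots. -/
theorem sq_sub_lt_mul_iff_between_roots {θ p κ s T : ℝ} (hθ : 0 < θ) (hp0 : 0 < p) (hp1 : p < 1)
    (hκp : p ≤ κ) (hκ : (p - κ) ^ 2 = θ * (κ * (1 - κ)))
    (hT : T = (2 * p + θ - Real.sqrt (θ ^ 2 + 4 * θ * p * (1 - p))) / (2 * (1 + θ))) :
    (p - s) ^ 2 < θ * (s * (1 - s)) ↔ T < s ∧ s < κ := by
  have hq : 0 < θ * p * (1 - p) := mul_pos (mul_pos hθ hp0) (sub_pos.2 hp1)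
  set D := Real.sqrt (θ ^ 2 + 4 * θ * p * (1 - p)) with hD
  have hD2 : D ^ 2 = θ ^ 2 + 4 * θ * p * (1 - p) := Real.sq_sqrt (by nlinarith [sq_nonneg θ])
  have hD0 : 0 ≤ D := Real.sqrt_nonneg _
  have hT' : 2 * (1 + θ) * T = 2 * p + θ - D := by
    rw [hT]
    field_simp
  have hlt : θ * (1 - 2 * p) < D := by
    refine lt_of_pow_lt_pow_left₀ 2 hD0 ?_
    nlinarith [mul_pos hq hθ]
  have hκD : 2 * (1 + θ) * κ = 2 * p + θ + D := by
    have h : (2 * (1 + θ) * κ - (2 * p + θ)) ^ 2 = D ^ 2 := by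
      rw [hD2]
      linear_combination 4 * (1 + θ) * hκ
    rcases sq_eq_sq_iff_eq_or_eq_neg.1 h with h | h
    · linarith
    · nlinarith [mul_nonneg hθ.le (sub_nonneg.2 hκp)]
  have hs : (p - s) ^ 2 < θ * (s * (1 - s)) ↔
      (2 * (1 + θ) * s - (2 * p + θ)) ^ 2 < D ^ 2 := by
    have e : (2 * (1 + θ) * s - (2 * p + θ)) ^ 2 - D ^ 2 =
        4 * (1 + θ) * ((p - s) ^ 2 - θ * (s * (1 - s))) := by
      rw [hD2]
      ring
    rw [← sub_neg, ← sub_neg (b := D ^ 2), e]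
    exact (smul_neg_iff_of_pos_left (by positivity : 0 < 4 * (1 + θ))).symm
  have h2 : 0 < 2 * (1 + θ) := by positivity
  rw [hs, sq_lt_sq, abs_of_nonneg hD0, abs_lt, ← mul_lt_mul_iff_right₀ h2 (b := T),
    ← mul_lt_mul_iff_right₀ h2 (c := κ), hT', hκD]
  constructor <;> rintro ⟨h, h'⟩ <;> constructor <;> linarith

/-- at `p = L(k)`, the coverage sum of the open Wald interval
equals `Pr{n·T⁻(p) < K < k}`. -/
theorem wald_open_coverage_at_lower (n : ℕ) (hn : 1 ≤ n) (z : ℝ) (hz : 0 < z)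
    (θ : ℝ) (hθdef : θ = z ^ 2 / n) (hθ : θ < 3)
    (L U : ℕ → ℝ)
    (hL : ∀ k, L k = (k : ℝ) / n - z * Real.sqrt (((k : ℝ) / n) * (1 - (k : ℝ) / n) / n))
    (hU : ∀ k, U k = (k : ℝ) / n + z * Real.sqrt (((k : ℝ) / n) * (1 - (k : ℝ) / n) / n))
    (Tm : ℝ → ℝ)
    (hTm : ∀ p, Tm p = (2 * p + θ - Real.sqrt (θ ^ 2 + 4 * θ * p * (1 - p))) / (2 * (1 + θ)))
    (k : ℕ) (hk : k ≤ n) (p : ℝ) (hp : p = L k) (hp0 : 0 < p) (hp1 : p < 1) :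
    ∑ j ∈ Finset.range (n + 1),
      (if L j < p ∧ p < U j then (1 : ℝ) else 0) * (n.choose j) * p ^ j * (1 - p) ^ (n - j) =
    ∑ j ∈ Finset.range (n + 1),
      (if (n : ℝ) * Tm p < (j : ℝ) ∧ j < k then (1 : ℝ) else 0) *
        (n.choose j) * p ^ j * (1 - p) ^ (n - j) := by
  have hn0 : (0 : ℝ) < n := by exact_mod_cast hn
  have hθ0 : 0 < θ := by
    rw [hθdef]
    positivity
  have hvar : ∀ j ≤ n, 0 ≤ (j : ℝ) / n * (1 - (j : ℝ) / n) / n := fun j hj => by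
    have h1 : (j : ℝ) / n ≤ 1 := (div_le_one hn0).2 (by exact_mod_cast hj)
    have h2 := sub_nonneg.2 h1
    positivity
  have hwidth : ∀ j ≤ n, (z * Real.sqrt ((j : ℝ) / n * (1 - (j : ℝ) / n) / n)) ^ 2 =
      θ * ((j : ℝ) / n * (1 - (j : ℝ) / n)) := fun j hj => by
    rw [mul_pow, Real.sq_sqrt (hvar j hj), hθdef]
    ring
  have hpL := hp.trans (hL k)
  have hκp : p ≤ (k : ℝ) / n := by
    rw [hpL]
    exact sub_le_self _ (by positivity)
  have hκ : (p - (k : ℝ) / n) ^ 2 = θ * ((k : ℝ) / n * (1 - (k : ℝ) / n)) := by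
    rw [← hwidth k hk, hpL]
    ring
  refine Finset.sum_congr rfl fun j hj => ?_
  have hjn : j ≤ n := Nat.lt_succ_iff.1 (Finset.mem_range.1 hj)
  have hcover : (L j < p ∧ p < U j) ↔ ((n : ℝ) * Tm p < (j : ℝ) ∧ j < k) := by
    have hleft : (L j < p ∧ p < U j) ↔
        (p - (j : ℝ) / n) ^ 2 < θ * ((j : ℝ) / n * (1 - (j : ℝ) / n)) := by
      rw [← hwidth j hjn, sq_lt_sq, abs_of_nonneg (a := z * _) (by positivity), abs_lt, hL, hU]
      constructor <;> rintro ⟨h, h'⟩ <;> constructor <;> linarith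
    rw [hleft, sq_sub_lt_mul_iff_between_roots hθ0 hp0 hp1 hκp hκ (hTm p), lt_div_iff₀' hn0,
      div_lt_div_iff_of_pos_right hn0, Nat.cast_lt]
  simp only [hcover]
end
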